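/- arXiv:1106.0349 — 2 statements merged into one kernel-verified Lean document; each statement's English description precedes it below -/
import Mathlib

section
/- Let T be a finite tree (a connected acyclic simple graph) on vertex set V, let v be a leaf of T and let r be the unique neighbor of v. Suppose (f, S) is a flow/balancing pair on T such that S(u) = 0 for every u ≠ v (no centroids in the subtree), flow conservation holds at every vertex u ≠ v, and f respects given turning ratios c at every vertex u ≠ v. Then: (i) f(r,v) = f(v,r); and (ii) f is uniquely determined by the value f(v,r): if (f', S') is another such pair respecting the same turning ratios c with f'(v,r) = f(v,r), then f' = f. (Lemma 6.2.) -/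
/-- On a finite vertex set, conservation at all vertices but one implies conservation everywhere. -/
theorem conservation_of_forall_ne {V : Type*} [Fintype V] (f : V → V → ℝ) (v : V)
    (h : ∀ u, u ≠ v → ∑ w, f w u = ∑ w, f u w) (u : V) : ∑ w, f w u = ∑ w, f u w := by
  classical
  rcases eq_or_ne u v with rfl | hu
  · have htotal : ∑ x, ∑ w, f w x = ∑ x, ∑ w, f x w := Finset.sum_comm
    rw [← Finset.add_sum_erase _ _ (Finset.mem_univ u),
      ← Finset.add_sum_erase _ (fun x => ∑ w, f x w) (Finset.mem_univ u),
      Finset.sum_congr rfl fun x hx => h x (Finset.ne_of_mem_erase hx)] at htotal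
    exact add_right_cancel htotal
  · exact h u hu

/-- The net amount of a conserved flow that leaves any vertex set is zero. -/
theorem sum_sum_compl_eq_of_conservation {V : Type*} [Fintype V] [DecidableEq V]
    (f : V → V → ℝ) (h : ∀ u, ∑ w, f w u = ∑ w, f u w) (A : Finset V) :
    ∑ u ∈ A, ∑ w ∈ Aᶜ, f u w = ∑ u ∈ A, ∑ w ∈ Aᶜ, f w u := by
  have hA : ∑ u ∈ A, ∑ w, f w u = ∑ u ∈ A, ∑ w, f u w := Finset.sum_congr rfl fun u _ => h u
  simp only [← Finset.sum_add_sum_compl A, Finset.sum_add_distrib] at hA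
  have hinner : ∑ u ∈ A, ∑ w ∈ A, f w u = ∑ u ∈ A, ∑ w ∈ A, f u w := Finset.sum_comm
  linarith

/-- A conserved flow carries equal amounts in the two directions of a bridge. -/
theorem flow_symm_of_isBridge {V : Type*} [Fintype V] {G : SimpleGraph V} (f : V → V → ℝ)
    (hf : ∀ u w, ¬ G.Adj u w → f u w = 0) (h : ∀ u, ∑ w, f w u = ∑ w, f u w)
    {a b : V} (hab : G.IsBridge s(a, b)) : f a b = f b a := by
  classical
  rw [SimpleGraph.isBridge_iff] at hab
  set H := G.deleteEdges {s(a, b)} with hH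
  set A : Finset V := Finset.univ.filter (H.Reachable a) with hA
  have ha : a ∈ A := by simp [hA]
  have hb : b ∈ Aᶜ := by simpa [hA] using hab
  have hcross : ∀ u ∈ A, ∀ w ∈ Aᶜ, ¬ (u = a ∧ w = b) → ¬ G.Adj u w := by
    intro u hu w hw hne hadj
    have hu' : H.Reachable a u := by simpa [hA] using hu
    have hw' : ¬ H.Reachable a w := by simpa [hA] using hw
    refine hw' (hu'.trans (SimpleGraph.Adj.reachable ?_))
    rw [hH, SimpleGraph.deleteEdges_adj]
    refine ⟨hadj, fun hmem => ?_⟩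
    rcases Sym2.eq_iff.mp (Set.mem_singleton_iff.mp hmem) with huw | ⟨-, rfl⟩
    · exact hne huw
    · exact hw' (SimpleGraph.Reachable.refl _)
  have hsum : ∀ g : V → V → ℝ, (∀ u w, ¬ G.Adj u w → g u w = 0) →
      ∑ u ∈ A, ∑ w ∈ Aᶜ, g u w = g a b := by
    intro g hg
    rw [Finset.sum_eq_single_of_mem a ha, Finset.sum_eq_single_of_mem b hb]
    · exact fun w hw hwb => hg a w (hcross a ha w hw fun hab => hwb hab.2)
    · exact fun u hu hua => Finset.sum_eq_zero fun w hw =>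
        hg u w (hcross u hu w hw fun hab => hua hab.1)
  have hcut := sum_sum_compl_eq_of_conservation f h A
  rwa [hsum f hf, hsum (fun u w => f w u) fun u w huw => hf w u fun hwu => huw hwu.symm] at hcut

/-- On a finite forest, a flow conserved at all vertices but one is symmetric. -/
theorem SimpleGraph.IsAcyclic.flow_symm {V : Type*} [Fintype V] {G : SimpleGraph V}
    (hG : G.IsAcyclic) (f : V → V → ℝ) (hf : ∀ u w, ¬ G.Adj u w → f u w = 0) (v : V)
    (h : ∀ u, u ≠ v → ∑ w, f w u = ∑ w, f u w) (a b : V) : f a b = f b a := by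
  by_cases hab : G.Adj a b
  · exact flow_symm_of_isBridge f hf (conservation_of_forall_ne f v h)
      (SimpleGraph.isAcyclic_iff_forall_adj_isBridge.mp hG hab)
  · rw [hf a b hab, hf b a fun hba => hab hba.symm]

/-- **Lemma 6.2.**  Let `T` be a finite tree, `v` a leaf of `T` with unique neighbor `r`.
Suppose `(f, S)` is a flow/balancing pair on `T` (vanishing on non-arcs) such that
`S` vanishes away from `v`, flow conservation holds at every vertex other than `v`, and
`f` respects the (positive) turning ratios `c` at every vertex other than `v`.  Then
(i) `f(r,v) = f(v,r)`, and (ii) `f` is uniquely determined by the value `f(v,r)`: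
any other such pair `(f', S')` with `f'(v,r) = f(v,r)` has `f' = f`. -/
theorem leafSubtreeLemma {V : Type*} [Fintype V] (T : SimpleGraph V) (hT : T.IsTree)
    (v r : V) (hvr : T.Adj v r) (hr : ∀ u, T.Adj v u → u = r)
    (c : V → V → ℝ) (hc : ∀ u w, T.Adj u w → 0 < c u w)
    (f : V → V → ℝ) (S : V → ℝ)
    (hf : ∀ u w, ¬ T.Adj u w → f u w = 0)
    (hS : ∀ u, u ≠ v → S u = 0)
    (hcons : ∀ u, u ≠ v → (∑ w, f w u) - (∑ w, f u w) + S u = 0)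
    (hturn : ∀ u, u ≠ v → ∀ w w', T.Adj u w → T.Adj u w' →
      f u w * c u w' = f u w' * c u w) :
    f r v = f v r ∧
    ∀ (f' : V → V → ℝ) (S' : V → ℝ),
      (∀ u w, ¬ T.Adj u w → f' u w = 0) →
      (∀ u, u ≠ v → S' u = 0) →
      (∀ u, u ≠ v → (∑ w, f' w u) - (∑ w, f' u w) + S' u = 0) →
      (∀ u, u ≠ v → ∀ w w', T.Adj u w → T.Adj u w' →
        f' u w * c u w' = f' u w' * c u w) →
      f' v r = f v r → f' = f := by
  have hsymm : ∀ (g : V → V → ℝ) (R : V → ℝ), (∀ u w, ¬ T.Adj u w → g u w = 0) →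
      (∀ u, u ≠ v → R u = 0) →
      (∀ u, u ≠ v → (∑ w, g w u) - (∑ w, g u w) + R u = 0) → ∀ a b, g a b = g b a := by
    intro g R hg hR hgcons
    refine hT.isAcyclic.flow_symm g hg v fun u hu => ?_
    linarith [hgcons u hu, hR u hu]
  have hfsymm := hsymm f S hf hS hcons
  refine ⟨hfsymm r v, fun f' S' hf' hS' hcons' hturn' hval => ?_⟩
  have hfsymm' := hsymm f' S' hf' hS' hcons'
  have hv : ∀ w, f' v w = f v w := by
    intro w
    by_cases hw : T.Adj v w
    · rw [hr w hw, hval]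
    · rw [hf v w hw, hf' v w hw]
  have hpropagate : ∀ u x, T.Adj u x → (∀ w, f' u w = f u w) → ∀ w, f' x w = f x w := by
    intro u x hux hu w
    rcases eq_or_ne x v with rfl | hx
    · exact hv w
    by_cases hw : T.Adj x w
    · refine mul_right_cancel₀ (hc x u hux.symm).ne' ?_
      rw [hturn' x hx w u hw hux.symm, hturn x hx w u hw hux.symm, hfsymm' x u, hfsymm x u, hu x]
    · rw [hf x w hw, hf' x w hw]
  funext u
  obtain ⟨p⟩ := hT.connected.preconnected v u
  have hwalk : ∀ {x y : V}, T.Walk x y → (∀ w, f' x w = f x w) → ∀ w, f' y w = f y w := by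
    intro x y q
    induction q with
    | nil => exact id
    | cons hadj _ ih => exact fun hx => ih (hpropagate _ _ hadj hx)
  exact funext (hwalk p hv)
end

section
/- There is a counterexample to the claimed sufficiency of the condition |B_i| ≤ |A_i(M)|: let G be the simple graph on six vertices a, b, c, d, e, f with edges {a,b}, {a,d}, {b,c}, {c,d}, {d,e}, {d,f}, let B = {e, f}, and let M = {a} (so A(M) = {b, d}, the unmonitored subgraph is a single component, and |B \ M| = |A(M)| = 2). Suppose all turning ratios are equal at each vertex, i.e., for every vertex u all its outgoing flows are equal: f(u,w) = f(u,w') for all neighbors w, w' of u. Then there exist two distinct pairs (f, S) ≠ (f', S'), each consisting of a flow and balancing-flow vector on G, such that both satisfy flow conservation at every vertex, both have S vanishing outside {e,f}, both have all outgoing flows from each vertex equal, and both take the value 4 on each of the four arcs (a,b), (b,a), (a,d), (d,a) and have S(a) = S'(a) = 0. In particular, monitoring M = {a} does not uniquely determine the flow on G, even though |B \ M| ≤ |A(M)|. -/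
/-- `A(M)`: the vertices not in `M` adjacent to some vertex of `M`. -/
def adjSet {V : Type*} (G : SimpleGraph V) (M : Set V) : Set V :=
  {v | v ∉ M ∧ ∃ m ∈ M, G.Adj v m}

/-- The counterexample graph on vertices `a,b,c,d,e,f = 0,1,2,3,4,5` with edges
`{a,b}, {a,d}, {b,c}, {c,d}, {d,e}, {d,f}`. -/
def Gcex : SimpleGraph (Fin 6) :=
  SimpleGraph.fromEdgeSet
    {s((0 : Fin 6), (1 : Fin 6)), s((0 : Fin 6), (3 : Fin 6)), s((1 : Fin 6), (2 : Fin 6)),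
      s((2 : Fin 6), (3 : Fin 6)), s((3 : Fin 6), (4 : Fin 6)), s((3 : Fin 6), (5 : Fin 6))}

instance Gcex.decidableRelAdj : DecidableRel Gcex.Adj :=
  fun u w => decidable_of_iff (s(u, w) ∈ ({s(0, 1), s(0, 3), s(1, 2), s(2, 3), s(3, 4), s(3, 5)} :
    Finset (Sym2 (Fin 6))) ∧ u ≠ w) (by simp [Gcex])

/-- The common outgoing flow at each vertex, for a one-parameter family of balanced flows. -/
def outFlow (t : ℝ) : Fin 6 → ℝ := ![4, 4, 4, 4, 4 + t, 4 - t]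

/-- The flow on `Gcex` sending `outFlow t u` along every arc out of `u`. -/
def equalTurningFlow (t : ℝ) (u w : Fin 6) : ℝ := if Gcex.Adj u w then outFlow t u else 0

/-- The balancing flow that makes `equalTurningFlow t` conserved. -/
def balancingFlow (t : ℝ) : Fin 6 → ℝ := ![0, 0, 0, 0, t, -t]

theorem equalTurningFlow_of_adj (t : ℝ) {u w : Fin 6} (h : Gcex.Adj u w) :
    equalTurningFlow t u w = outFlow t u := if_pos h

theorem equalTurningFlow_of_not_adj (t : ℝ) (u w : Fin 6) (h : ¬ Gcex.Adj u w) :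
    equalTurningFlow t u w = 0 := if_neg h

theorem equalTurningFlow_eq_of_adj (t : ℝ) (u w w' : Fin 6) (h : Gcex.Adj u w)
    (h' : Gcex.Adj u w') : equalTurningFlow t u w = equalTurningFlow t u w' := by
  rw [equalTurningFlow_of_adj t h, equalTurningFlow_of_adj t h']

theorem equalTurningFlow_conservation (t : ℝ) (x : Fin 6) :
    (∑ u, equalTurningFlow t u x) - (∑ u, equalTurningFlow t x u) + balancingFlow t x = 0 := by
  fin_cases x <;>
    simp [equalTurningFlow, balancingFlow, outFlow, Fin.sum_univ_six, Gcex]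
  ring

theorem balancingFlow_eq_zero (t : ℝ) (x : Fin 6) (hx : x ∉ ({4, 5} : Set (Fin 6))) :
    balancingFlow t x = 0 := by
  fin_cases x <;> simp_all [balancingFlow]

theorem adjSet_Gcex : adjSet Gcex {0} = ({1, 3} : Set (Fin 6)) := by
  ext v
  fin_cases v <;> simp [adjSet, Gcex]

/-- **Counterexample to Theorem 3.1's sufficiency.**  On the graph `Gcex` with centroids
`B = {e, f} = {4, 5}` and monitored set `M = {a} = {0}` (so `A(M) = {b, d} = {1, 3}` and
`|B \ M| = |A(M)| = 2`), there are two distinct flow/balancing pairs, both conserving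
flow everywhere, both with balancing flow vanishing outside `{e, f}`, both with all
outgoing flows from each vertex equal (equal turning ratios), and both taking the value
`4` on the arcs `(a,b), (b,a), (a,d), (d,a)` with `S a = S' a = 0`.  Hence monitoring
`M = {a}` does not uniquely determine the flow, even though `|B \ M| ≤ |A(M)|`. -/
theorem counterexampleThm31 :
    adjSet Gcex {0} = ({1, 3} : Set (Fin 6)) ∧
    ∃ (f f' : Fin 6 → Fin 6 → ℝ) (S S' : Fin 6 → ℝ),
      ¬(f = f' ∧ S = S') ∧
      (∀ u w, ¬ Gcex.Adj u w → f u w = 0) ∧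
      (∀ u w, ¬ Gcex.Adj u w → f' u w = 0) ∧
      (∀ x, (∑ u, f u x) - (∑ u, f x u) + S x = 0) ∧
      (∀ x, (∑ u, f' u x) - (∑ u, f' x u) + S' x = 0) ∧
      (∀ x, x ∉ ({4, 5} : Set (Fin 6)) → S x = 0) ∧
      (∀ x, x ∉ ({4, 5} : Set (Fin 6)) → S' x = 0) ∧
      (∀ u w w', Gcex.Adj u w → Gcex.Adj u w' → f u w = f u w') ∧
      (∀ u w w', Gcex.Adj u w → Gcex.Adj u w' → f' u w = f' u w') ∧
      f 0 1 = 4 ∧ f 1 0 = 4 ∧ f 0 3 = 4 ∧ f 3 0 = 4 ∧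
      f' 0 1 = 4 ∧ f' 1 0 = 4 ∧ f' 0 3 = 4 ∧ f' 3 0 = 4 ∧
      S 0 = 0 ∧ S' 0 = 0 := by
  refine ⟨adjSet_Gcex, equalTurningFlow 0, equalTurningFlow 1, balancingFlow 0, balancingFlow 1,
    fun h => ?_, equalTurningFlow_of_not_adj 0, equalTurningFlow_of_not_adj 1,
    equalTurningFlow_conservation 0, equalTurningFlow_conservation 1,
    balancingFlow_eq_zero 0, balancingFlow_eq_zero 1,
    equalTurningFlow_eq_of_adj 0, equalTurningFlow_eq_of_adj 1, ?_⟩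
  · simpa [balancingFlow] using congrFun h.2 4
  · simp [equalTurningFlow, outFlow, balancingFlow, Gcex]
end
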